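/- arXiv:2304.08163 — 6 statements merged into one kernel-verified Lean document; each statement's English description precedes it below -/
import Mathlib

section
/- (Fermionic Gaussian partition function equals the determinant.) In the exterior algebra Λ(ℂ^{2n}), the n-th power of the quadratic action element S satisfies S^{∧n} = n!·det(A)·Ω, where the product is the exterior (wedge) product. -/
/-- The generator xᵢ of Λ(ℂ^{2n}): the image of the i-th standard basis vector
of the first block of ℂ^{2n} = ℂ^n ⊕ ℂ^n in the exterior algebra. -/
noncomputable def xGen (n : ℕ) (i : Fin n) : ExteriorAlgebra ℂ (Fin n ⊕ Fin n → ℂ) :=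
  ExteriorAlgebra.ι ℂ (Pi.single (Sum.inl i) 1)

/-- The generator yⱼ of Λ(ℂ^{2n}). -/
noncomputable def yGen (n : ℕ) (j : Fin n) : ExteriorAlgebra ℂ (Fin n ⊕ Fin n → ℂ) :=
  ExteriorAlgebra.ι ℂ (Pi.single (Sum.inr j) 1)

/-- The quadratic action element S = Σᵢⱼ Aᵢⱼ · xᵢ ∧ yⱼ. -/
noncomputable def actionS (n : ℕ) (A : Matrix (Fin n) (Fin n) ℂ) :
    ExteriorAlgebra ℂ (Fin n ⊕ Fin n → ℂ) :=
  ∑ i : Fin n, ∑ j : Fin n, A i j • (xGen n i * yGen n j)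

/-- The top form Ω = x₁ ∧ y₁ ∧ x₂ ∧ y₂ ∧ ⋯ ∧ xₙ ∧ yₙ. -/
noncomputable def topForm (n : ℕ) : ExteriorAlgebra ℂ (Fin n ⊕ Fin n → ℂ) :=
  ((List.finRange n).map fun i => xGen n i * yGen n i).prod

theorem Commute.add_pow_succ_of_sq_eq_zero {R : Type*} [Semiring R] {t s : R} (h : Commute t s)
    (ht : t * t = 0) (k : ℕ) :
    (t + s) ^ (k + 1) = s ^ (k + 1) + (k + 1 : ℕ) • (t * s ^ k) := by
  induction k with
  | zero => simp [add_comm]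
  | succ k ih =>
    have hs : t * s ^ k * t = 0 := by
      rw [mul_assoc, ← (h.pow_right k).eq, ← mul_assoc, ht, zero_mul]
    rw [pow_succ, ih, add_mul, mul_add, smul_mul_assoc, mul_add, hs, mul_assoc t, ← pow_succ,
      ← pow_succ, ← (h.pow_right (k + 1)).eq, zero_add,
      succ_nsmul _ (k + 1)]
    abel

/-- For pairwise commuting elements of square zero, the only surviving terms of the power of their
sum of exponent the number of terms are the squarefree ones, and the next power vanishes. -/
theorem List.sum_pow_length_of_sq_eq_zero {R : Type*} [Semiring R] (l : List R)
    (hc : ∀ a ∈ l, ∀ b ∈ l, Commute a b) (hs : ∀ a ∈ l, a * a = 0) :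
    l.sum ^ l.length = l.length.factorial • l.prod ∧ l.sum ^ (l.length + 1) = 0 := by
  induction l with
  | nil => simp
  | cons t l ih =>
    obtain ⟨h₁, h₂⟩ := ih (fun a ha b hb => hc a (by simp [ha]) b (by simp [hb]))
      (fun a ha => hs a (by simp [ha]))
    have ht : Commute t l.sum :=
      Commute.list_sum_right _ _ fun b hb => hc t (by simp) b (by simp [hb])
    have key := ht.add_pow_succ_of_sq_eq_zero (hs t (by simp))
    rw [List.sum_cons, List.length_cons, List.prod_cons]
    refine ⟨?_, ?_⟩
    · rw [key, h₂, h₁, zero_add, mul_smul_comm, smul_smul, Nat.factorial_succ]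
    · rw [key, pow_succ, h₂, zero_mul, mul_zero, smul_zero, add_zero]

theorem AlternatingMap.map_sum_smul_eq_det_smul {R M N ι : Type*} [CommRing R] [AddCommGroup M]
    [Module R M] [AddCommGroup N] [Module R N] [Fintype ι] [DecidableEq ι]
    (g : M [⋀^ι]→ₗ[R] N) (A : Matrix ι ι R) (v : ι → M) :
    g (fun i => ∑ j, A i j • v j) = A.det • g v := by
  have h : g.compLinearMap (Fintype.linearCombination R v) =
      (LinearMap.toSpanSingleton R N (g v)).compAlternatingMap (Pi.basisFun R ι).det := by
    refine Module.Basis.ext_alternating (Pi.basisFun R ι) fun i hi => ?_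
    let σ : Equiv.Perm ι := Equiv.ofBijective i (Finite.injective_iff_bijective.1 hi)
    have hv : (fun j => Fintype.linearCombination R v (Pi.basisFun R ι (σ j))) = v ∘ σ := by
      ext j
      simp
    change g (fun j => Fintype.linearCombination R v (Pi.basisFun R ι (σ j))) =
      (Pi.basisFun R ι).det (Pi.basisFun R ι ∘ σ) • g v
    rw [hv, AlternatingMap.map_perm, AlternatingMap.map_perm, Module.Basis.det_self]
    simp
  have hA := congrArg (fun g => g A.row) h
  rw [Pi.basisFun_det] at hA
  exact hA

namespace ExteriorAlgebra

variable {R M : Type*} [CommRing R] [AddCommGroup M] [Module R M]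

theorem ι_mul_ι_eq_neg (a b : M) : ι R a * ι R b = -(ι R b * ι R a) :=
  eq_neg_of_add_eq_zero_left (ι_add_mul_swap a b)

theorem commute_ι_mul_ι (a b c d : M) : Commute (ι R a * ι R b) (ι R c * ι R d) := by
  have h (c : M) : Commute (ι R a * ι R b) (ι R c) := by
    rw [commute_iff_eq, mul_assoc, ι_mul_ι_eq_neg b c, mul_neg, ← mul_assoc, ι_mul_ι_eq_neg a c,
      neg_mul, neg_neg, mul_assoc]
  exact (h c).mul_right (h d)

theorem ι_mul_ι_mul_self (a b : M) : ι R a * ι R b * (ι R a * ι R b) = 0 := by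
  rw [mul_assoc, ← mul_assoc (ι R b), ι_mul_ι_eq_neg b a, neg_mul, mul_assoc, ι_sq_zero,
    mul_zero, neg_zero, mul_zero]

theorem ι_mul_ιMulti {m : ℕ} (b : M) (a : Fin m → M) :
    ι R b * ιMulti R m a = (-1 : R) ^ m • (ιMulti R m a * ι R b) := by
  induction m with
  | zero => simp
  | succ m ih =>
    rw [ιMulti_succ_apply, ← mul_assoc, ι_mul_ι_eq_neg, neg_mul, mul_assoc, ih, pow_succ,
      mul_smul_comm, mul_neg_one, neg_smul, mul_assoc]

/-- Separating the factors of a product of pairs costs a sign depending only on the number of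
pairs. -/
theorem exists_prod_ι_mul_ι_eq_smul (R M : Type*) [CommRing R] [AddCommGroup M] [Module R M]
    (m : ℕ) : ∃ ε : R, ∀ a b : Fin m → M,
      (List.ofFn fun i => ι R (a i) * ι R (b i)).prod =
        ε • (ιMulti R m a * ιMulti R m b) := by
  induction m with
  | zero => exact ⟨1, fun a b => by simp⟩
  | succ m ih =>
    obtain ⟨ε, hε⟩ := ih
    refine ⟨ε * (-1) ^ m, fun a b => ?_⟩
    have hb := ι_mul_ιMulti (R := R) (b 0) (Matrix.vecTail a)
    rw [List.ofFn_succ, List.prod_cons, hε (fun i => a i.succ) (fun i => b i.succ),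
      ιMulti_succ_apply, ιMulti_succ_apply, mul_smul_comm, mul_smul]
    congr 1
    change _ * (ιMulti R m (Matrix.vecTail a) * ιMulti R m (Matrix.vecTail b)) = _
    rw [mul_assoc, ← mul_assoc (ι R (b 0)), hb, smul_mul_assoc, mul_smul_comm]
    simp only [mul_assoc]

end ExteriorAlgebra

/-- the fermionic Gaussian partition function is the determinant:
S^{∧n} = n! · det A · Ω in Λ(ℂ^{2n}). -/
theorem actionS_pow_eq_det_smul_topForm (n : ℕ) (A : Matrix (Fin n) (Fin n) ℂ) :
    actionS n A ^ n = ((n.factorial : ℂ) * A.det) • topForm n := by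
  let e (i : Fin n) : Fin n ⊕ Fin n → ℂ := Pi.single (Sum.inl i) 1
  let f (j : Fin n) : Fin n ⊕ Fin n → ℂ := Pi.single (Sum.inr j) 1
  let w (i : Fin n) : Fin n ⊕ Fin n → ℂ := ∑ j, A i j • f j
  let l := List.ofFn fun i => ExteriorAlgebra.ι ℂ (e i) * ExteriorAlgebra.ι ℂ (w i)
  have hS : actionS n A = l.sum := by
    simp only [l, w, List.sum_ofFn, map_sum, map_smul, Finset.mul_sum, mul_smul_comm]
    rfl
  have hΩ : topForm n =
      (List.ofFn fun i => ExteriorAlgebra.ι ℂ (e i) * ExteriorAlgebra.ι ℂ (f i)).prod := by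
    rw [List.ofFn_eq_map]
    rfl
  obtain ⟨ε, hε⟩ := ExteriorAlgebra.exists_prod_ι_mul_ι_eq_smul ℂ (Fin n ⊕ Fin n → ℂ) n
  have hl : l.prod = A.det • topForm n := by
    rw [hΩ, hε e w, hε e f, AlternatingMap.map_sum_smul_eq_det_smul, mul_smul_comm, smul_comm]
  have hpow := (l.sum_pow_length_of_sq_eq_zero
    (by simp only [l, List.forall_mem_ofFn_iff]
        exact fun i j => ExteriorAlgebra.commute_ι_mul_ι _ _ _ _)
    (by simp only [l, List.forall_mem_ofFn_iff]
        exact fun i => ExteriorAlgebra.ι_mul_ι_mul_self _ _)).1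
  rw [show l.length = n from List.length_ofFn] at hpow
  rw [hS, hpow, hl, mul_smul, Nat.cast_smul_eq_nsmul]
end

section
/- (Fermionic Gaussian correlation functions as minors.) Let 1 ≤ m ≤ n, and let 1 ≤ i₁ < ⋯ < i_m ≤ n and 1 ≤ j₁ < ⋯ < j_m ≤ n. Then in Λ(ℂ^{2n}): (x_{i₁}∧y_{j₁}∧x_{i₂}∧y_{j₂}∧⋯∧x_{i_m}∧y_{j_m}) ∧ S^{∧(n−m)} = (n−m)!·ε_{IJ}·det(A_{ÎĴ})·Ω, where ε_{IJ} = (−1)^{i₁+⋯+i_m+j₁+⋯+j_m} and A_{ÎĴ} is the (n−m)×(n−m) matrix obtained from A by deleting the rows with indices i₁,…,i_m and the columns with indices j₁,…,j_m. -/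
open ExteriorAlgebra in
/-- Separating the two families of vectors in an interleaved product costs a scalar that does not
depend on the vectors. -/
theorem exists_prod_ofFn_ι_mul_ι_eq_smul {R M : Type*} [CommRing R] [AddCommGroup M] [Module R M]
    (p : ℕ) : ∃ s : R, ∀ u w : Fin p → M,
      (List.ofFn fun k => ι R (u k) * ι R (w k)).prod = s • (ιMulti R p u * ιMulti R p w) := by
  have hcomm (q : ℕ) : ∃ t : R, ∀ (x : M) (u : Fin q → M),
      ι R x * ιMulti R q u = t • (ιMulti R q u * ι R x) := by
    induction q with
    | zero => exact ⟨1, fun x u => by simp⟩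
    | succ q ih =>
      obtain ⟨t, ht⟩ := ih
      refine ⟨-t, fun x u => ?_⟩
      have hswap := eq_neg_of_add_eq_zero_left (ι_add_mul_swap (R := R) x (u 0))
      rw [ιMulti_succ_apply, ← mul_assoc, hswap, neg_mul, mul_assoc, ht, mul_smul_comm, neg_smul,
        mul_assoc]
  induction p with
  | zero => exact ⟨1, fun u w => by simp⟩
  | succ p ih =>
    obtain ⟨s, hs⟩ := ih
    obtain ⟨t, ht⟩ := hcomm p
    refine ⟨s * t, fun u w => ?_⟩
    have htail := hs (fun k => u k.succ) (fun k => w k.succ)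
    rw [List.ofFn_succ, List.prod_cons, htail, ιMulti_succ_apply, ιMulti_succ_apply,
      mul_smul_comm]
    change s • (_ * (ιMulti R p (Matrix.vecTail u) * ιMulti R p (Matrix.vecTail w))) = _
    rw [mul_assoc, ← mul_assoc (ι R (w 0)), ht, smul_mul_assoc, mul_smul_comm, smul_smul]
    simp only [mul_assoc]

/-- The sign of a shuffle, up to the normalization by the sum of the positions. -/
theorem sign_mul_neg_one_pow_of_strictMono_append {m N : ℕ} (π : Equiv.Perm (Fin (m + N)))
    (hl : StrictMono fun k => π (Fin.castAdd N k)) (hr : StrictMono fun l => π (Fin.natAdd m l)) :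
    Equiv.Perm.sign π * (-1) ^ (∑ k : Fin m, (k : ℕ))
      = (-1) ^ (∑ k : Fin m, (π (Fin.castAdd N k) : ℕ)) := by
  have hcard (k : Fin m) :
      (Finset.univ.filter fun l : Fin N => ¬ π (Fin.castAdd N k) < π (Fin.natAdd m l)).card
        + (k : ℕ) = π (Fin.castAdd N k) := by
    have htotal : (∑ p : Fin (m + N), if π p < π (Fin.castAdd N k) then 1 else 0)
        = (π (Fin.castAdd N k) : ℕ) := by
      rw [Equiv.sum_comp π (fun p => if p < π (Fin.castAdd N k) then 1 else 0),
        ← Finset.card_filter]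
      simp [Finset.filter_gt_eq_Iio]
    have hleft : (∑ k' : Fin m, if π (Fin.castAdd N k') < π (Fin.castAdd N k) then 1 else 0)
        = (k : ℕ) := by
      simp only [hl.lt_iff_lt, ← Finset.card_filter]
      simp [Finset.filter_gt_eq_Iio]
    have hne (l : Fin N) : π (Fin.natAdd m l) ≠ π (Fin.castAdd N k) := by
      rw [Ne, π.injective.eq_iff, Fin.ext_iff]
      simp only [Fin.val_natAdd, Fin.val_castAdd]
      omega
    rw [Fin.sum_univ_add, hleft] at htotal
    rw [← htotal, Finset.card_filter, add_comm]
    congr 1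
    refine Finset.sum_congr rfl fun l _ => ?_
    have := hne l
    grind
  have hsign : Equiv.Perm.sign π = ∏ k : Fin m, (-1) ^
      (Finset.univ.filter fun l : Fin N => ¬ π (Fin.castAdd N k) < π (Fin.natAdd m l)).card := by
    rw [π.sign_eq_prod_prod_Ioi]
    simp only [← Finset.filter_lt_eq_Ioi, Finset.prod_filter]
    rw [Fin.prod_univ_add]
    have hlow (l : Fin N) : ∏ q : Fin (m + N), (if Fin.natAdd m l < q then
        (if π (Fin.natAdd m l) < π q then (1 : ℤˣ) else -1) else 1) = 1 := by
      refine Finset.prod_eq_one fun q _ => ?_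
      refine Fin.addCases (fun k => ?_) (fun l' => ?_) q
      · rw [if_neg]
        simp only [Fin.lt_def, Fin.val_natAdd, Fin.val_castAdd]
        omega
      · simp only [Fin.natAdd_lt_natAdd_iff, hr.lt_iff_lt]
        grind
    rw [Finset.prod_congr rfl fun l _ => hlow l, Finset.prod_const_one, mul_one]
    refine Finset.prod_congr rfl fun k _ => ?_
    rw [Fin.prod_univ_add]
    have hlow' : ∏ k' : Fin m, (if Fin.castAdd N k < Fin.castAdd N k' then
        (if π (Fin.castAdd N k) < π (Fin.castAdd N k') then (1 : ℤˣ) else -1) else 1) = 1 := by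
      refine Finset.prod_eq_one fun k' _ => ?_
      have hiff : Fin.castAdd N k < Fin.castAdd N k' ↔ k < k' := Iff.rfl
      simp only [hiff, hl.lt_iff_lt]
      grind
    rw [hlow', one_mul, ← Finset.prod_const, Finset.prod_filter]
    refine Finset.prod_congr rfl fun l _ => ?_
    have hlt : Fin.castAdd N k < Fin.natAdd m l := by
      simp only [Fin.lt_def, Fin.val_natAdd, Fin.val_castAdd]
      omega
    rw [if_pos hlt]
    grind
  rw [hsign, ← Finset.prod_pow_eq_pow_sum, ← Finset.prod_mul_distrib,
    ← Finset.prod_pow_eq_pow_sum]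
  refine Finset.prod_congr rfl fun k _ => ?_
  rw [← pow_add, hcard]

section Complement

variable {m N : ℕ} {i : Fin m → Fin (m + N)} {i' : Fin N → Fin (m + N)}

theorem append_injective_of_range_eq_compl (hi : StrictMono i) (hi' : StrictMono i')
    (h : Set.range i' = (Set.range i)ᶜ) : Function.Injective (Fin.append i i') :=
  Fin.append_injective_iff.2 ⟨hi.injective, hi'.injective, fun k l hkl => by
    have hl : i' l ∈ (Set.range i)ᶜ := h ▸ Set.mem_range_self l
    exact hl ⟨k, hkl⟩⟩

/-- Alternating a family over complementary increasing index tuples. -/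
theorem ιMulti_append_eq_neg_one_pow_smul {R M : Type*} [CommRing R] [AddCommGroup M] [Module R M]
    (hi : StrictMono i) (hi' : StrictMono i') (h : Set.range i' = (Set.range i)ᶜ)
    (v : Fin (m + N) → M) :
    ExteriorAlgebra.ιMulti R m (v ∘ i) * ExteriorAlgebra.ιMulti R N (v ∘ i')
      = ((-1 : R) ^ ((∑ k : Fin m, (i k : ℕ)) + ∑ k : Fin m, (k : ℕ))) •
        ExteriorAlgebra.ιMulti R (m + N) v := by
  let π : Equiv.Perm (Fin (m + N)) := Equiv.ofBijective (Fin.append i i')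
    (Finite.injective_iff_bijective.1 (append_injective_of_range_eq_compl hi hi' h))
  have hπl (k : Fin m) : π (Fin.castAdd N k) = i k := Fin.append_left i i' k
  have hπr (l : Fin N) : π (Fin.natAdd m l) = i' l := Fin.append_right i i' l
  have hv : Fin.append (v ∘ i) (v ∘ i') = v ∘ π := by
    funext p
    refine Fin.addCases (fun k => ?_) (fun l => ?_) p <;> simp [hπl, hπr]
  have hsign := sign_mul_neg_one_pow_of_strictMono_append π (by simpa only [hπl] using hi)
    (by simpa only [hπr] using hi')
  simp only [hπl] at hsign
  have hsign' : Equiv.Perm.sign π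
      = (-1) ^ ((∑ k : Fin m, (i k : ℕ)) + ∑ k : Fin m, (k : ℕ)) := by
    rw [pow_add, ← hsign, mul_assoc, Int.units_mul_self, mul_one]
  rw [ExteriorAlgebra.ιMulti_mul_ιMulti, hv, AlternatingMap.map_perm, hsign']
  rcases Nat.even_or_odd ((∑ k : Fin m, (i k : ℕ)) + ∑ k : Fin m, (k : ℕ)) with he | he <;>
    simp [he.neg_one_pow]

/-- A sum over all tuples whose terms vanish unless the tuple completes `i` to an injective tuple
is a sum over the rearrangements of the complementary tuple. -/
theorem sum_eq_sum_perm_of_range_eq_compl {E : Type*} [AddCommMonoid E]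
    (hi' : StrictMono i') (h : Set.range i' = (Set.range i)ᶜ)
    (F : (Fin N → Fin (m + N)) → E)
    (hF : ∀ a, ¬ Function.Injective (Fin.append i a) → F a = 0) :
    ∑ a, F a = ∑ σ : Equiv.Perm (Fin N), F (i' ∘ σ) := by
  symm
  refine Finset.sum_of_injOn (fun σ : Equiv.Perm (Fin N) => i' ∘ σ) ?_ (by simp) ?_ (by simp)
  · intro σ _ τ _ hστ
    exact Equiv.ext fun l => hi'.injective (congrFun hστ l)
  · intro a _ ha
    refine hF a fun hinj => ha ?_
    obtain ⟨-, hainj, hne⟩ := Fin.append_injective_iff.1 hinj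
    have hmem (l : Fin N) : ∃ l', i' l' = a l := by
      change a l ∈ Set.range i'
      rw [h]
      rintro ⟨k, hk⟩
      exact hne k l hk
    choose f hf using hmem
    have hfinj : Function.Injective f := fun l l' hll => hainj (by rw [← hf, ← hf, hll])
    exact ⟨Equiv.ofBijective f (Finite.injective_iff_bijective.1 hfinj), by simp, funext hf⟩

theorem ιMulti_mul_ιMulti_comp_eq_zero {R M : Type*} [CommRing R] [AddCommGroup M] [Module R M]
    (v : Fin (m + N) → M) {a : Fin N → Fin (m + N)}
    (ha : ¬ Function.Injective (Fin.append i a)) :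
    ExteriorAlgebra.ιMulti R m (v ∘ i) * ExteriorAlgebra.ιMulti R N (v ∘ a) = 0 := by
  rw [ExteriorAlgebra.ιMulti_mul_ιMulti]
  refine ExteriorAlgebra.ιMulti_eq_zero_of_not_inj fun hinj => ha ?_
  have hv : Fin.append (v ∘ i) (v ∘ a) = v ∘ Fin.append i a := by
    funext p
    refine Fin.addCases (fun k => ?_) (fun l => ?_) p <;> simp
  rw [hv] at hinj
  exact hinj.of_comp

/-- Modulo the vectors indexed by `i`, linear combinations of a family wedge to the determinant of
their coefficients along the complementary indices. -/
theorem ιMulti_mul_ιMulti_sum_smul {R M : Type*} [CommRing R] [AddCommGroup M] [Module R M]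
    (hi' : StrictMono i') (h : Set.range i' = (Set.range i)ᶜ)
    (v : Fin (m + N) → M) (B : Matrix (Fin N) (Fin (m + N)) R) :
    ExteriorAlgebra.ιMulti R m (v ∘ i) *
        ExteriorAlgebra.ιMulti R N (fun k => ∑ l, B k l • v l)
      = (B.submatrix id i').det •
        (ExteriorAlgebra.ιMulti R m (v ∘ i) * ExteriorAlgebra.ιMulti R N (v ∘ i')) := by
  have hexpand : ExteriorAlgebra.ιMulti R N (fun k => ∑ l, B k l • v l)
      = ∑ b : Fin N → Fin (m + N), (∏ k, B k (b k)) • ExteriorAlgebra.ιMulti R N (v ∘ b) := by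
    rw [← AlternatingMap.coe_multilinearMap, MultilinearMap.map_sum]
    exact Finset.sum_congr rfl fun b _ => MultilinearMap.map_smul_univ _ _ _
  rw [hexpand, Finset.mul_sum]
  simp only [mul_smul_comm]
  rw [sum_eq_sum_perm_of_range_eq_compl hi' h _ fun a ha => by
    rw [ιMulti_mul_ιMulti_comp_eq_zero v ha, smul_zero]]
  rw [← Matrix.det_transpose, Matrix.det_apply', Finset.sum_smul]
  refine Finset.sum_congr rfl fun σ _ => ?_
  rw [← Function.comp_assoc, AlternatingMap.map_perm, mul_smul_comm, Units.smul_def,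
    ← Int.cast_smul_eq_zsmul R, smul_smul, mul_comm]
  rfl

end Complement

/-- fermionic Gaussian correlation functions as minors:
(x_{i₁} ∧ y_{j₁} ∧ ⋯ ∧ x_{i_m} ∧ y_{j_m}) ∧ S^{∧(n−m)} = (n−m)! · ε_{IJ} · det(A_ÎĴ) · Ω,
where ε_{IJ} = (−1)^{Σ(i_k+1)+Σ(j_k+1)} (1-based indices) and A_ÎĴ is obtained from A by
deleting the rows i₁,…,i_m and the columns j₁,…,j_m; the deleted minor is expressed as
the submatrix along the strictly monotone enumerations i′, j′ of the complementary
row and column indices. -/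
theorem wedge_actionS_pow_eq_minor_smul_topForm
    (n m : ℕ) (hm1 : 1 ≤ m) (hmn : m ≤ n)
    (A : Matrix (Fin n) (Fin n) ℂ)
    (i j : Fin m → Fin n) (hi : StrictMono i) (hj : StrictMono j)
    (i' j' : Fin (n - m) → Fin n) (hi' : StrictMono i') (hj' : StrictMono j')
    (hi'r : Set.range i' = (Set.range i)ᶜ) (hj'r : Set.range j' = (Set.range j)ᶜ) :
    ((List.finRange m).map fun k => xGen n (i k) * yGen n (j k)).prod
        * actionS n A ^ (n - m)
      = (((n - m).factorial : ℂ) *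
          ((-1 : ℂ) ^ ((∑ k : Fin m, ((i k : ℕ) + 1)) + ∑ k : Fin m, ((j k : ℕ) + 1)) *
            (A.submatrix i' j').det)) • topForm n := by
  generalize hN : n - m = N at *
  obtain rfl : n = m + N := by omega
  obtain ⟨s, hs⟩ := exists_prod_ofFn_ι_mul_ι_eq_smul (R := ℂ)
    (M := Fin (m + N) ⊕ Fin (m + N) → ℂ) (m + N)
  let x : Fin (m + N) → (Fin (m + N) ⊕ Fin (m + N) → ℂ) := fun p => Pi.single (Sum.inl p) 1
  let y : Fin (m + N) → (Fin (m + N) ⊕ Fin (m + N) → ℂ) := fun p => Pi.single (Sum.inr p) 1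
  let r : Fin (m + N) → (Fin (m + N) ⊕ Fin (m + N) → ℂ) := fun p => ∑ q, A p q • y q
  have htop : topForm (m + N)
      = s • (ExteriorAlgebra.ιMulti ℂ _ x * ExteriorAlgebra.ιMulti ℂ _ y) := by
    rw [topForm, ← List.ofFn_eq_map]
    exact hs x y
  have hS : actionS (m + N) A = ∑ p, ExteriorAlgebra.ι ℂ (x p) * ExteriorAlgebra.ι ℂ (r p) := by
    rw [actionS]
    refine Finset.sum_congr rfl fun p _ => ?_
    simp only [r, map_sum, map_smul, Finset.mul_sum, mul_smul_comm]
    rfl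
  have hpow : actionS (m + N) A ^ N = ∑ a : Fin N → Fin (m + N), (List.ofFn fun k =>
      ExteriorAlgebra.ι ℂ (x (a k)) * ExteriorAlgebra.ι ℂ (r (a k))).prod := by
    rw [hS, ← MultilinearMap.mkPiAlgebraFin_apply_const (R := ℂ), MultilinearMap.map_sum]
    simp only [MultilinearMap.mkPiAlgebraFin_apply]
  have hterm (a : Fin N → Fin (m + N)) :
      (List.ofFn fun k => xGen (m + N) (i k) * yGen (m + N) (j k)).prod *
        (List.ofFn fun k =>
          ExteriorAlgebra.ι ℂ (x (a k)) * ExteriorAlgebra.ι ℂ (r (a k))).prod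
      = s • ((ExteriorAlgebra.ιMulti ℂ m (x ∘ i) * ExteriorAlgebra.ιMulti ℂ N (x ∘ a)) *
          (ExteriorAlgebra.ιMulti ℂ m (y ∘ j) * ExteriorAlgebra.ιMulti ℂ N (r ∘ a))) := by
    rw [ExteriorAlgebra.ιMulti_mul_ιMulti, ExteriorAlgebra.ιMulti_mul_ιMulti, ← hs,
      ← List.prod_append, ← List.ofFn_fin_append]
    congr 2
    funext p
    refine Fin.addCases (fun k => ?_) (fun l => ?_) p
    · simp only [Fin.append_left]
      rfl
    · simp only [Fin.append_right]
      rfl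
  have hperm (σ : Equiv.Perm (Fin N)) :
      (ExteriorAlgebra.ιMulti ℂ m (x ∘ i) * ExteriorAlgebra.ιMulti ℂ N (x ∘ (i' ∘ σ))) *
          (ExteriorAlgebra.ιMulti ℂ m (y ∘ j) * ExteriorAlgebra.ιMulti ℂ N (r ∘ (i' ∘ σ)))
      = (ExteriorAlgebra.ιMulti ℂ m (x ∘ i) * ExteriorAlgebra.ιMulti ℂ N (x ∘ i')) *
          (ExteriorAlgebra.ιMulti ℂ m (y ∘ j) * ExteriorAlgebra.ιMulti ℂ N (r ∘ i')) := by
    rw [← Function.comp_assoc, ← Function.comp_assoc, AlternatingMap.map_perm,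
      AlternatingMap.map_perm, mul_smul_comm, mul_smul_comm, smul_mul_assoc, mul_smul_comm,
      smul_smul, Int.units_mul_self, one_smul]
  have hdet : ExteriorAlgebra.ιMulti ℂ m (y ∘ j) * ExteriorAlgebra.ιMulti ℂ N (r ∘ i')
      = (A.submatrix i' j').det •
        (ExteriorAlgebra.ιMulti ℂ m (y ∘ j) * ExteriorAlgebra.ιMulti ℂ N (y ∘ j')) :=
    ιMulti_mul_ιMulti_sum_smul hj' hj'r y (A.submatrix i' id)
  have hsign : (-1 : ℂ) ^ ((∑ k : Fin m, ((i k : ℕ) + 1)) + ∑ k : Fin m, ((j k : ℕ) + 1))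
      = (-1) ^ ((∑ k : Fin m, (i k : ℕ)) + ∑ k : Fin m, (k : ℕ)) *
        (-1) ^ ((∑ k : Fin m, (j k : ℕ)) + ∑ k : Fin m, (k : ℕ)) := by
    have hsq : ((-1 : ℂ) ^ m) * (-1) ^ m = 1 := by rw [← mul_pow]; norm_num
    have hsq' : ((-1 : ℂ) ^ (∑ k : Fin m, (k : ℕ))) * (-1) ^ (∑ k : Fin m, (k : ℕ)) = 1 := by
      rw [← mul_pow]; norm_num
    simp only [Finset.sum_add_distrib, Finset.sum_const, Finset.card_univ, Fintype.card_fin,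
      smul_eq_mul, mul_one, pow_add]
    linear_combination ((-1 : ℂ) ^ (∑ k : Fin m, (i k : ℕ))) *
      ((-1 : ℂ) ^ (∑ k : Fin m, (j k : ℕ))) * (hsq - hsq')
  rw [← List.ofFn_eq_map, hpow, Finset.mul_sum]
  simp only [hterm]
  rw [sum_eq_sum_perm_of_range_eq_compl hi' hi'r _ fun a ha => by
    rw [ιMulti_mul_ιMulti_comp_eq_zero x ha, zero_mul, smul_zero]]
  simp only [hperm]
  rw [Finset.sum_const, Finset.card_univ, Fintype.card_perm, Fintype.card_fin, hdet,
    ιMulti_append_eq_neg_one_pow_smul hi hi' hi'r, ιMulti_append_eq_neg_one_pow_smul hj hj' hj'r,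
    htop, hsign, ← Nat.cast_smul_eq_nsmul ℂ]
  simp only [smul_mul_assoc, mul_smul_comm, smul_smul]
  congr 1
  ring
end

section
/- (Wick's theorem for fermionic Gaussian correlations, matrix form.) Let A be an invertible complex n×n matrix, let 1 ≤ m ≤ n, and let 1 ≤ i₁ < ⋯ < i_m ≤ n and 1 ≤ j₁ < ⋯ < j_m ≤ n. Then (−1)^{i₁+⋯+i_m+j₁+⋯+j_m}·det(A_{ÎĴ}) = det(A) · Σ_{σ∈S_m} sgn(σ) ∏_{k=1}^m (A⁻¹)_{j_{σ(k)}, i_k}, where A_{ÎĴ} is the (n−m)×(n−m) matrix obtained from A by deleting the rows with indices i₁,…,i_m and the columns with indices j₁,…,j_m, and (A⁻¹)_{j,i} denotes the (j,i) entry of the inverse matrix. (This identity expresses that the m-point fermionic Gaussian correlation ⟨x_{i₁}y_{j₁}⋯x_{i_m}y_{j_m}⟩ = ε_{IJ}·det(A_{ÎĴ})/det(A) equals the signed sum over pairings of the two-point correlations ⟨x_i y_j⟩ = (A⁻¹)_{j,i}.) -/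
/-- **Jacobi's complementary minor identity** in block form. -/
theorem Matrix.det_mul_det_toBlocks₁₁_of_mul_eq_one {R ι κ : Type*} [CommRing R]
    [Fintype ι] [DecidableEq ι] [Fintype κ] [DecidableEq κ]
    {M N : Matrix (ι ⊕ κ) (ι ⊕ κ) R} (h : M * N = 1) :
    M.det * N.toBlocks₁₁.det = M.toBlocks₂₂.det := by
  rw [← M.fromBlocks_toBlocks, ← N.fromBlocks_toBlocks, fromBlocks_multiply, ← fromBlocks_one,
    fromBlocks_inj] at h
  obtain ⟨h₁₁, -, h₂₁, -⟩ := h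
  have key : M * fromBlocks N.toBlocks₁₁ 0 N.toBlocks₂₁ 1 =
      fromBlocks 1 M.toBlocks₁₂ 0 M.toBlocks₂₂ := by
    conv_lhs => rw [← M.fromBlocks_toBlocks]
    simp [fromBlocks_multiply, h₁₁, h₂₁]
  simpa using congrArg det key

/-- The permutation listing the values of `f` first and then those of `g`, where `g` enumerates
the complement of the range of `f`. -/
noncomputable def shufflePerm {m p : ℕ} (f : Fin m → Fin (m + p)) (g : Fin p → Fin (m + p))
    (hf : StrictMono f) (hg : StrictMono g) (hfg : Set.range g = (Set.range f)ᶜ) :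
    Equiv.Perm (Fin (m + p)) :=
  Equiv.ofBijective (Fin.append f g) <| Finite.injective_iff_bijective.mp <|
    Fin.append_injective_iff.mpr ⟨hf.injective, hg.injective, fun k l h =>
      (hfg.subset (Set.mem_range_self l)) ⟨k, h⟩⟩

section shufflePerm

variable {m p : ℕ} {f : Fin m → Fin (m + p)} {g : Fin p → Fin (m + p)}

@[simp]
theorem shufflePerm_castAdd (hf : StrictMono f) (hg : StrictMono g)
    (hfg : Set.range g = (Set.range f)ᶜ) (k : Fin m) :
    shufflePerm f g hf hg hfg (Fin.castAdd p k) = f k := by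
  simp [shufflePerm]

@[simp]
theorem shufflePerm_natAdd (hf : StrictMono f) (hg : StrictMono g)
    (hfg : Set.range g = (Set.range f)ᶜ) (l : Fin p) :
    shufflePerm f g hf hg hfg (Fin.natAdd m l) = g l := by
  simp [shufflePerm]

theorem card_filter_lt_add_val (hf : StrictMono f) (hg : StrictMono g)
    (hfg : Set.range g = (Set.range f)ᶜ) (k : Fin m) :
    (Finset.univ.filter fun l => g l < f k).card + (k : ℕ) = f k := by
  have h : ∑ x, (if shufflePerm f g hf hg hfg x < f k then 1 else 0) = (f k : ℕ) := by
    rw [Equiv.sum_comp (shufflePerm f g hf hg hfg) (fun x => if x < f k then 1 else 0),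
      ← Finset.card_filter, Finset.filter_gt_eq_Iio, Fin.card_Iio]
  rw [Fin.sum_univ_add] at h
  simp only [shufflePerm_castAdd, shufflePerm_natAdd, hf.lt_iff_lt, ← Finset.card_filter,
    Finset.filter_gt_eq_Iio, Fin.card_Iio] at h
  omega

theorem sign_shufflePerm_mul (hf : StrictMono f) (hg : StrictMono g)
    (hfg : Set.range g = (Set.range f)ᶜ) :
    Equiv.Perm.sign (shufflePerm f g hf hg hfg) * (-1) ^ (∑ k : Fin m, (k : ℕ)) =
      (-1) ^ (∑ k, (f k : ℕ)) := by
  have hinv : Equiv.Perm.sign (shufflePerm f g hf hg hfg) =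
      ∏ k : Fin m, (-1) ^ (Finset.univ.filter fun l => g l < f k).card := by
    rw [Equiv.Perm.sign_eq_prod_prod_Iio]
    simp_rw [← Finset.filter_gt_eq_Iio, Finset.prod_filter, Fin.prod_univ_add]
    have h₁ (k : Fin m) (l : Fin p) : Fin.castAdd p k < Fin.natAdd m l := by
      simp only [Fin.lt_def, Fin.val_castAdd, Fin.val_natAdd]
      omega
    have h₂ (k k' : Fin m) : Fin.castAdd p k < Fin.castAdd p k' ↔ k < k' := by
      simp only [Fin.lt_def, Fin.val_castAdd]
    have h₃ (l l' : Fin p) : Fin.natAdd m l < Fin.natAdd m l' ↔ l < l' := by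
      simp only [Fin.lt_def, Fin.val_natAdd, Nat.add_lt_add_iff_left]
    have h₄ (k : Fin m) (l : Fin p) : f k < g l ↔ ¬ g l < f k := by
      have : f k ≠ g l := fun h => hfg.subset (Set.mem_range_self l) ⟨k, h⟩
      grind
    simp only [shufflePerm_castAdd, shufflePerm_natAdd, h₁, h₂, h₃, hf.lt_iff_lt, hg.lt_iff_lt,
      (h₁ _ _).not_gt, if_true, if_false, h₄, ite_not]
    have h₅ {q : ℕ} (a b : Fin q) : (if a < b then (if a < b then 1 else -1) else 1 : ℤˣ) = 1 := by
      split_ifs <;> rfl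
    simp only [h₅, Finset.prod_const_one, mul_one, one_mul]
    rw [Finset.prod_comm]
    simp [Finset.prod_ite]
  rw [hinv, ← Finset.prod_pow_eq_pow_sum, ← Finset.prod_pow_eq_pow_sum, ← Finset.prod_mul_distrib]
  refine Finset.prod_congr rfl fun k _ => ?_
  rw [← pow_add, card_filter_lt_add_val hf hg hfg]

end shufflePerm

theorem Matrix.det_submatrix_perm {R ι : Type*} [CommRing R] [Fintype ι] [DecidableEq ι]
    (A : Matrix ι ι R) (σ τ : Equiv.Perm ι) :
    (A.submatrix σ τ).det =
      ((Equiv.Perm.sign σ * Equiv.Perm.sign τ : ℤˣ) : ℤ) * A.det := by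
  have : A.submatrix σ τ = (A.submatrix id τ).submatrix σ id := by simp
  rw [this, det_permute, det_permute']
  push_cast
  ring

/-- **Jacobi's complementary minor identity** for ordered index sets. -/
theorem Matrix.neg_one_pow_mul_det_submatrix_compl {R : Type*} [CommRing R] {m p : ℕ}
    (A : Matrix (Fin (m + p)) (Fin (m + p)) R) (hA : IsUnit A.det)
    {i j : Fin m → Fin (m + p)} (hi : StrictMono i) (hj : StrictMono j)
    {i' j' : Fin p → Fin (m + p)} (hi' : StrictMono i') (hj' : StrictMono j')
    (hii' : Set.range i' = (Set.range i)ᶜ) (hjj' : Set.range j' = (Set.range j)ᶜ) :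
    (-1) ^ ((∑ k, (i k : ℕ)) + ∑ k, (j k : ℕ)) * (A.submatrix i' j').det =
      A.det * (A⁻¹.submatrix j i).det := by
  set σ := shufflePerm i i' hi hi' hii' with hσ
  set τ := shufflePerm j j' hj hj' hjj' with hτ
  let e : Fin m ⊕ Fin p ≃ Fin (m + p) := finSumFinEquiv
  have hmul : (A.submatrix σ τ).submatrix e e * (A⁻¹.submatrix τ σ).submatrix e e = 1 := by
    rw [submatrix_mul_equiv, submatrix_mul_equiv, mul_nonsing_inv A hA,
      submatrix_one_equiv, submatrix_one_equiv]
  have hjac := det_mul_det_toBlocks₁₁_of_mul_eq_one hmul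
  have h₁₁ : ((A⁻¹.submatrix τ σ).submatrix e e).toBlocks₁₁ = A⁻¹.submatrix j i := by
    ext k l
    simp [e, toBlocks₁₁, hσ, hτ]
  have h₂₂ : ((A.submatrix σ τ).submatrix e e).toBlocks₂₂ = A.submatrix i' j' := by
    ext k l
    simp [e, toBlocks₂₂, hσ, hτ]
  rw [h₁₁, h₂₂, det_submatrix_equiv_self, det_submatrix_perm] at hjac
  have hsign : Equiv.Perm.sign σ * Equiv.Perm.sign τ =
      (-1) ^ ((∑ k, (i k : ℕ)) + ∑ k, (j k : ℕ)) := by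
    rw [pow_add, ← sign_shufflePerm_mul hi hi' hii', ← sign_shufflePerm_mul hj hj' hjj',
      mul_mul_mul_comm, ← mul_pow]
    simp [hσ, hτ]
  rw [hsign] at hjac
  rw [← hjac]
  push_cast
  rw [← mul_assoc, ← mul_assoc, ← mul_pow]
  simp

/-- Wick's theorem for fermionic Gaussian correlations, matrix form:
ε_{IJ} · det(A_ÎĴ) = det A · Σ_{σ∈S_m} sgn σ ∏ₖ (A⁻¹)_{j_{σ(k)}, i_k},
where ε_{IJ} = (−1)^{Σ(i_k+1)+Σ(j_k+1)} (1-based indices) and A_ÎĴ is obtained from A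
by deleting the rows i₁,…,i_m and the columns j₁,…,j_m; the deleted minor is expressed
as the submatrix along the strictly monotone enumerations i′, j′ of the complementary
row and column indices. -/
theorem minor_eq_det_mul_wick_sum
    (n m : ℕ) (hm1 : 1 ≤ m) (hmn : m ≤ n)
    (A : Matrix (Fin n) (Fin n) ℂ) (hA : IsUnit A.det)
    (i j : Fin m → Fin n) (hi : StrictMono i) (hj : StrictMono j)
    (i' j' : Fin (n - m) → Fin n) (hi' : StrictMono i') (hj' : StrictMono j')
    (hi'r : Set.range i' = (Set.range i)ᶜ) (hj'r : Set.range j' = (Set.range j)ᶜ) :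
    (-1 : ℂ) ^ ((∑ k : Fin m, ((i k : ℕ) + 1)) + ∑ k : Fin m, ((j k : ℕ) + 1)) *
        (A.submatrix i' j').det
      = A.det * ∑ σ : Equiv.Perm (Fin m), ((Equiv.Perm.sign σ : ℤ) : ℂ) *
          ∏ k : Fin m, A⁻¹ (j (σ k)) (i k) := by
  obtain ⟨p, rfl⟩ := Nat.exists_eq_add_of_le hmn
  generalize hp : m + p - m = q at i' j'
  obtain rfl : q = p := by omega
  have hpow : (-1 : ℂ) ^ ((∑ k : Fin m, ((i k : ℕ) + 1)) + ∑ k : Fin m, ((j k : ℕ) + 1)) =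
      (-1) ^ ((∑ k, (i k : ℕ)) + ∑ k, (j k : ℕ)) := by
    simp only [Finset.sum_add_distrib, add_add_add_comm _ (∑ _, 1)]
    rw [pow_add _ (_ + _), (Even.add_self _).neg_one_pow, mul_one]
  rw [hpow, Matrix.neg_one_pow_mul_det_submatrix_compl A hA hi hj hi' hj' hi'r hj'r,
    Matrix.det_apply' (A⁻¹.submatrix j i)]
  rfl
end

section
/- (Commutator of a Virasoro mode with a normally ordered fermion bilinear.) For all n, m, l, k ∈ ℤ, as linear operators on V: Lₙ ∘ :χ⁺_l χ⁻_k:_m − :χ⁺_l χ⁻_k:_m ∘ Lₙ = −k·:χ⁺_l χ⁻_{n+k}:_{−(l+k)} − l·:χ⁺_{n+l} χ⁻_k:_{l+k}. (Note that the right-hand side does not depend on the normal-ordering threshold m.) -/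
variable {V : Type*} [AddCommGroup V] [Module ℂ V]

/-- The normally ordered product :χ⁺ₘ χ⁻ₙ:ₖ with threshold k:
χ⁺ₘ ∘ χ⁻ₙ if n − m ≥ k, and −χ⁻ₙ ∘ χ⁺ₘ otherwise. -/
noncomputable def nord (χp χm : ℤ → Module.End ℂ V) (k m n : ℤ) : Module.End ℂ V :=
  if k ≤ n - m then χp m * χm n else -(χm n * χp m)

/-- The Sugawara/Virasoro mode Lₙ v = Σ_{k∈ℤ} :χ⁺_{n−k} χ⁻ₖ:₀ v (a finite sum on each
vector, by the truncation property assumed in the theorems below). -/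
noncomputable def Vir (χp χm : ℤ → Module.End ℂ V) (n : ℤ) (v : V) : V :=
  ∑ᶠ k : ℤ, nord χp χm 0 (n - k) k v

/-- Anticommutation relations of symplectic-fermion current modes:
{χ⁻ₙ, χ⁺ₘ} = n δ_{n+m,0} id, {χ⁺ₙ, χ⁺ₘ} = 0, {χ⁻ₙ, χ⁻ₘ} = 0. -/
def AnticommRel (χp χm : ℤ → Module.End ℂ V) : Prop :=
  (∀ n m : ℤ, χm n * χp m + χp m * χm n
      = (if n + m = 0 then (n : ℂ) else 0) • (1 : Module.End ℂ V)) ∧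
  (∀ n m : ℤ, χp n * χp m + χp m * χp n = 0) ∧
  (∀ n m : ℤ, χm n * χm m + χm m * χm n = 0)

/-- Truncation: for each vector v there is N with χ^α_m (χ^β_n v) = 0 for all n ≥ N,
all m and all α, β ∈ {+,−}. -/
def Truncation (χp χm : ℤ → Module.End ℂ V) : Prop :=
  ∀ v : V, ∃ N : ℤ, ∀ n : ℤ, N ≤ n → ∀ m : ℤ,
    χp m (χp n v) = 0 ∧ χp m (χm n v) = 0 ∧ χm m (χp n v) = 0 ∧ χm m (χm n v) = 0

/-- The normally ordered product differs from the plain product by a scalar. -/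
theorem nord_eq_mul_sub_smul_one {χp χm : ℤ → Module.End ℂ V} (hanti : AnticommRel χp χm)
    (t m n : ℤ) :
    nord χp χm t m n = χp m * χm n
      - (if t ≤ n - m then 0 else if n + m = 0 then (n : ℂ) else 0) • (1 : Module.End ℂ V) := by
  unfold nord
  split_ifs with h₁ h₂
  · simp
  · have h := hanti.1 n m
    rw [if_pos h₂] at h
    rw [← h]
    abel
  · have h := hanti.1 n m
    rw [if_neg h₂] at h
    rw [← h]
    abel

theorem finite_support_nord {χp χm : ℤ → Module.End ℂ V} (htrunc : Truncation χp χm)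
    (n : ℤ) (v : V) : (Function.support fun j : ℤ => nord χp χm 0 (n - j) j v).Finite := by
  obtain ⟨N, hN⟩ := htrunc v
  refine (Set.finite_Icc (min (n - N) n) (max N n)).subset fun j hj => ?_
  by_contra hout
  apply hj
  simp only [Set.mem_Icc, not_and_or, not_le] at hout
  dsimp only [nord]
  split_ifs with h
  · exact (hN j (by omega) (n - j)).2.1
  · have h' := (hN (n - j) (by omega) j).2.2.1
    simp [h']

/-- The commutator of two bilinears in fermionic operators whose mixed anticommutators
are scalars. -/
theorem mul_mul_comm_of_anticomm {A B C D : Module.End ℂ V} {a b : ℂ}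
    (hBC : B * C + C * B = b • 1) (hDA : D * A + A * D = a • 1)
    (hAC : A * C + C * A = 0) (hBD : B * D + D * B = 0) :
    A * B * (C * D) - C * D * (A * B) = b • (A * D) - a • (C * B) := by
  have h₁ : b • (A * D) = A * (B * C + C * B) * D := by rw [hBC]; simp
  have h₂ : a • (C * B) = C * (D * A + A * D) * B := by rw [hDA]; simp
  have h₃ : A * C = -(C * A) := eq_neg_of_add_eq_zero_left hAC
  have h₄ : B * D = -(D * B) := eq_neg_of_add_eq_zero_left hBD
  have h₅ : A * C * (B * D) = C * A * (D * B) := by rw [h₃, h₄, neg_mul_neg]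
  rw [h₁, h₂, ← sub_eq_zero]
  rw [← sub_eq_zero] at h₅
  rw [← neg_eq_zero, ← h₅]
  noncomm_ring

theorem nord_comm_nord {χp χm : ℤ → Module.End ℂ V} (hanti : AnticommRel χp χm)
    (s t n j l k : ℤ) :
    nord χp χm s (n - j) j * nord χp χm t l k - nord χp χm t l k * nord χp χm s (n - j) j
      = (if j = -l then -(l : ℂ) • (χp (n + l) * χm k) else 0)
        - (if j = n + k then (k : ℂ) • (χp l * χm (n + k)) else 0) := by
  have h := mul_mul_comm_of_anticomm (hanti.1 j l) (hanti.1 k (n - j))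
    (hanti.2.1 (n - j) l) (hanti.2.2 j k)
  rw [nord_eq_mul_sub_smul_one hanti, nord_eq_mul_sub_smul_one hanti]
  generalize (if s ≤ j - (n - j) then (0 : ℂ) else _) = c
  generalize (if t ≤ k - l then (0 : ℂ) else _) = d
  trans χp (n - j) * χm j * (χp l * χm k) - χp l * χm k * (χp (n - j) * χm j)
  · simp only [sub_mul, mul_sub, smul_mul_assoc, mul_smul_comm, one_mul, mul_one]
    module
  rw [h]
  congr 1
  · by_cases hj : j = -l
    · subst hj
      simp
    · rw [if_neg hj, if_neg (by omega), zero_smul]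
  · by_cases hj : j = n + k
    · subst hj
      simp
    · rw [if_neg hj, if_neg (by omega), zero_smul]

/-- The thresholds `-(l + k)` and `l + k` make the scalar corrections cancel. -/
theorem smul_nord_add_smul_nord {χp χm : ℤ → Module.End ℂ V} (hanti : AnticommRel χp χm)
    (n l k : ℤ) :
    (k : ℂ) • nord χp χm (-(l + k)) l (n + k) + (l : ℂ) • nord χp χm (l + k) (n + l) k
      = (k : ℂ) • (χp l * χm (n + k)) + (l : ℂ) • (χp (n + l) * χm k) := by
  rw [nord_eq_mul_sub_smul_one hanti, nord_eq_mul_sub_smul_one hanti]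
  by_cases h : n + k + l = 0
  · obtain rfl : n = -(k + l) := by omega
    by_cases hkl : l ≤ k
    · rw [if_pos (by omega : -(l + k) ≤ -(k + l) + k - l),
        if_pos (by omega : l + k ≤ k - (-(k + l) + l))]
      simp
    · rw [if_neg (by omega : ¬ -(l + k) ≤ -(k + l) + k - l),
        if_neg (by omega : ¬ l + k ≤ k - (-(k + l) + l)), if_pos h,
        if_pos (by omega : k + (-(k + l) + l) = 0)]
      push_cast
      module
  · rw [if_neg h, if_neg (by omega : ¬ k + (n + l) = 0)]
    simp

/-- commutator of a Virasoro mode with a normally ordered fermion bilinear: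
[Lₙ, :χ⁺_l χ⁻_k:ₘ] = −k·:χ⁺_l χ⁻_{n+k}:_{−(l+k)} − l·:χ⁺_{n+l} χ⁻_k:_{l+k}. -/
theorem vir_comm_nord
    (χp χm : ℤ → Module.End ℂ V)
    (hanti : AnticommRel χp χm) (htrunc : Truncation χp χm)
    (n m l k : ℤ) (v : V) :
    Vir χp χm n (nord χp χm m l k v) - nord χp χm m l k (Vir χp χm n v)
      = -(k : ℂ) • nord χp χm (-(l + k)) l (n + k) v
        - (l : ℂ) • nord χp χm (l + k) (n + l) k v := by
  set X := nord χp χm m l k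
  have hfin := finite_support_nord htrunc n
  have hmap : X (Vir χp χm n v) = ∑ᶠ j : ℤ, X (nord χp χm 0 (n - j) j v) :=
    X.toAddMonoidHom.map_finsum (hfin v)
  have hfinX : (Function.support fun j : ℤ => X (nord χp χm 0 (n - j) j v)).Finite :=
    (hfin v).subset fun j hj h0 => hj (by simp only [h0, map_zero])
  have hterm (j : ℤ) : nord χp χm 0 (n - j) j (X v) - X (nord χp χm 0 (n - j) j v)
      = (if j = -l then -(l : ℂ) • χp (n + l) (χm k v) else 0)
        - (if j = n + k then (k : ℂ) • χp l (χm (n + k) v) else 0) := by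
    have h := LinearMap.congr_fun (nord_comm_nord hanti 0 m n j l k) v
    split_ifs at h ⊢ <;> simpa using h
  have hfinite (i : ℤ) (x : V) : (Function.support fun j : ℤ => if j = i then x else 0).Finite :=
    (Set.finite_singleton i).subset fun j hj => by_contra fun h => hj (if_neg h)
  have hsum (i : ℤ) (x : V) : ∑ᶠ j : ℤ, (if j = i then x else 0) = x := by
    rw [finsum_eq_single _ i fun j hj => if_neg hj, if_pos rfl]
  rw [hmap, Vir, ← finsum_sub_distrib (hfin _) hfinX, finsum_congr hterm,
    finsum_sub_distrib (hfinite _ _) (hfinite _ _), hsum, hsum]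
  have h := LinearMap.congr_fun (smul_nord_add_smul_nord hanti n l k) v
  simp only [LinearMap.add_apply, LinearMap.smul_apply, Module.End.mul_apply] at h
  rw [neg_smul, neg_smul, ← neg_add', ← neg_add', h, add_comm]
end

section
/- (Weighted difference of two normal orderings is a central term.) For every n ∈ ℤ and every m ∈ ℤ with m ≠ 0, and every v ∈ V (the sum below having only finitely many nonzero terms): Σ_{k∈ℤ} k·( :χ⁺_{n+m−k} χ⁻ₖ:_m v − :χ⁺_{n+m−k} χ⁻ₖ:_{−m} v ) = −( (m³−m)/12 + (m/4)·[|m| is even] ) · δ_{n+m,0} · v, where [P] equals 1 if P holds and 0 otherwise. -/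
variable {V : Type*} [AddCommGroup V] [Module ℂ V]

theorem sum_Ico_neg_natCast_sq (p : ℕ) :
    ∑ k ∈ Finset.Ico (-(p : ℤ)) p, (k : ℂ) ^ 2 = (2 * (p : ℂ) ^ 3 + p) / 3 := by
  induction p with
  | zero => simp
  | succ p ih =>
    have h : Finset.Ico (-((p + 1 : ℕ) : ℤ)) ((p + 1 : ℕ) : ℤ)
        = insert (-((p : ℤ) + 1)) (insert (p : ℤ) (Finset.Ico (-(p : ℤ)) p)) := by
      ext k
      simp only [Finset.mem_Ico, Finset.mem_insert]
      omega
    rw [h, Finset.sum_insert, Finset.sum_insert, ih]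
    · push_cast
      ring
    all_goals
      simp only [Finset.mem_Ico, Finset.mem_insert]
      omega

theorem sum_Ico_neg_div_two_sq (M : ℕ) :
    ∑ k ∈ Finset.Ico (-((M : ℤ) / 2)) (((M : ℤ) + 1) / 2), (k : ℂ) ^ 2
      = ((M : ℂ) ^ 3 - M) / 12 + (if (M : ℤ) % 2 = 0 then (M : ℂ) / 4 else 0) := by
  rcases Nat.even_or_odd' M with ⟨p, rfl | rfl⟩
  · have h : Finset.Ico (-(((2 * p : ℕ) : ℤ) / 2)) ((((2 * p : ℕ) : ℤ) + 1) / 2)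
        = Finset.Ico (-(p : ℤ)) p := by
      congr 1 <;> omega
    rw [h, sum_Ico_neg_natCast_sq, if_pos (by omega)]
    push_cast
    ring
  · have h : Finset.Ico (-(((2 * p + 1 : ℕ) : ℤ) / 2)) ((((2 * p + 1 : ℕ) : ℤ) + 1) / 2)
        = insert (p : ℤ) (Finset.Ico (-(p : ℤ)) p) := by
      ext k
      simp only [Finset.mem_Ico, Finset.mem_insert]
      omega
    rw [h, Finset.sum_insert (by simp), sum_Ico_neg_natCast_sq, if_neg (by omega)]
    push_cast
    ring

theorem AnticommRel.nord_sub_nord_neg {χp χm : ℤ → Module.End ℂ V} (hanti : AnticommRel χp χm)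
    (s k : ℤ) (M : ℕ) (v : V) :
    (k : ℂ) • (nord χp χm M (s - k) k v - nord χp χm (-M) (s - k) k v)
      = if -(M : ℤ) ≤ 2 * k - s ∧ 2 * k - s < M then (if s = 0 then -(k : ℂ) ^ 2 else 0) • v
        else 0 := by
  have h := congrArg (fun f : Module.End ℂ V => f v) (hanti.1 k (s - k))
  simp only [add_sub_cancel, LinearMap.add_apply, LinearMap.smul_apply, Module.End.one_apply] at h
  unfold nord
  by_cases h₁ : (M : ℤ) ≤ k - (s - k)
  · rw [if_pos h₁, if_pos (by omega), if_neg (by omega), sub_self, smul_zero]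
  · by_cases h₂ : -(M : ℤ) ≤ k - (s - k)
    · rw [if_neg h₁, if_pos h₂, if_pos (by omega), LinearMap.neg_apply, ← neg_add', h, ← neg_smul,
        smul_smul]
      congr 1
      split_ifs <;> ring
    · rw [if_neg h₁, if_neg h₂, if_neg (by omega), sub_self, smul_zero]

theorem AnticommRel.finsum_nord_sub_nord_neg {χp χm : ℤ → Module.End ℂ V}
    (hanti : AnticommRel χp χm) (s : ℤ) (M : ℕ) (v : V) :
    ∑ᶠ k : ℤ, (k : ℂ) • (nord χp χm M (s - k) k v - nord χp χm (-M) (s - k) k v)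
      = (if s = 0 then
            -(((M : ℂ) ^ 3 - M) / 12 + (if (M : ℤ) % 2 = 0 then (M : ℂ) / 4 else 0))
          else 0) • v := by
  simp only [hanti.nord_sub_nord_neg]
  split_ifs with hs h₂
  all_goals try simp only [zero_smul, ite_self, finsum_zero]
  all_goals
    subst hs
    rw [finsum_eq_sum_of_support_subset
      (s := Finset.Ico (-((M : ℤ) / 2)) (((M : ℤ) + 1) / 2))]
    · have h := sum_Ico_neg_div_two_sq M
      simp only [h₂, if_true, if_false] at h
      rw [← h, ← Finset.sum_neg_distrib, Finset.sum_smul]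
      refine Finset.sum_congr rfl fun k hk => ?_
      rw [Finset.mem_Ico] at hk
      rw [if_pos (by omega)]
    · intro k hk
      have hk' := (ite_ne_right_iff.mp hk).1
      rw [Finset.mem_coe, Finset.mem_Ico]
      omega

/-- the weighted difference of two normal orderings is a central term:
Σₖ k·(:χ⁺_{n+m−k} χ⁻ₖ:ₘ v − :χ⁺_{n+m−k} χ⁻ₖ:₋ₘ v)
  = −((m³−m)/12 + (m/4)·[|m| even])·δ_{n+m,0}·v. -/
theorem nord_weighted_difference_central
    (χp χm : ℤ → Module.End ℂ V)
    (hanti : AnticommRel χp χm) (htrunc : Truncation χp χm)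
    (n m : ℤ) (hm : m ≠ 0) (v : V) :
    ∑ᶠ k : ℤ, (k : ℂ) •
        (nord χp χm m (n + m - k) k v - nord χp χm (-m) (n + m - k) k v)
      = (if n + m = 0 then
            -((((m : ℂ)) ^ 3 - (m : ℂ)) / 12 + (if m % 2 = 0 then (m : ℂ) / 4 else 0))
          else 0) • v := by
  obtain ⟨M, rfl | rfl⟩ := m.eq_nat_or_neg
  · simpa using hanti.finsum_nord_sub_nord_neg (n + M) M v
  · have h := congrArg Neg.neg (hanti.finsum_nord_sub_nord_neg (n + -M) M v)
    rw [← finsum_neg_distrib] at h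
    simp only [← smul_neg, neg_sub] at h
    rw [neg_neg, h, smul_neg, ← neg_smul]
    congr 1
    have hpar : -(M : ℤ) % 2 = 0 ↔ (M : ℤ) % 2 = 0 := by omega
    simp only [hpar]
    split_ifs <;> push_cast <;> ring
end

section
/- (Virasoro relations with central charge −2.) For all n, m ∈ ℤ, the Sugawara operators Lₙ satisfy, as linear operators on V: Lₙ ∘ Lₘ − Lₘ ∘ Lₙ = (n−m)·L_{n+m} + (c/12)·(n³−n)·δ_{n+m,0}·id_V with c = −2, i.e. [Lₙ, Lₘ] = (n−m)·L_{n+m} − ((n³−n)/6)·δ_{n+m,0}·id_V. In particular, the operators Lₙ define a representation of the Virasoro algebra with central charge −2 on V. -/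
variable {V : Type*} [AddCommGroup V] [Module ℂ V]

section SymplecticFermionModes

variable {χp χm : ℤ → Module.End ℂ V}

theorem AnticommRel.minus_plus_apply (h : AnticommRel χp χm) (n m : ℤ) (v : V) :
    χm n (χp m v) = (if n + m = 0 then (n : ℂ) else 0) • v - χp m (χm n v) := by
  have := congrArg (fun f : Module.End ℂ V => f v) (h.1 n m)
  exact eq_sub_of_add_eq this

theorem AnticommRel.plus_plus_apply (h : AnticommRel χp χm) (n m : ℤ) (v : V) :
    χp n (χp m v) = -χp m (χp n v) := by
  have := congrArg (fun f : Module.End ℂ V => f v) (h.2.1 n m)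
  exact eq_neg_of_add_eq_zero_left (by simpa using this)

theorem AnticommRel.minus_minus_apply (h : AnticommRel χp χm) (n m : ℤ) (v : V) :
    χm n (χm m v) = -χm m (χm n v) := by
  have := congrArg (fun f : Module.End ℂ V => f v) (h.2.2 n m)
  exact eq_neg_of_add_eq_zero_left (by simpa using this)

/-- Modes of large index annihilate any given vector: a vector killed by all modes vanishes,
because the modes `χ⁻₁` and `χ⁺₋₁` anticommute to the identity. -/
theorem Truncation.exists_forall_apply_eq_zero (ht : Truncation χp χm)
    (h : AnticommRel χp χm) (v : V) :
    ∃ N : ℤ, ∀ n, N ≤ n → χp n v = 0 ∧ χm n v = 0 := by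
  obtain ⟨N, hN⟩ := ht v
  refine ⟨N, fun n hn => ⟨?_, ?_⟩⟩
  · have := h.minus_plus_apply 1 (-1) (χp n v)
    rw [(hN n hn (-1)).1, (hN n hn 1).2.2.1] at this
    simpa using this.symm
  · have := h.minus_plus_apply 1 (-1) (χm n v)
    rw [(hN n hn (-1)).2.1, (hN n hn 1).2.2.2] at this
    simpa using this.symm

/-- The product of `χ⁺_{p-k}` and `χ⁻ₖ`, ordered according to whether `k` is at least `T`. -/
noncomputable def cutoffProd (χp χm : ℤ → Module.End ℂ V) (T p k : ℤ) : Module.End ℂ V :=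
  if T ≤ k then χp (p - k) * χm k else -(χm k * χp (p - k))

theorem cutoffProd_support_finite (h : AnticommRel χp χm) (ht : Truncation χp χm)
    (T p : ℤ) (v : V) : (Function.support fun k => cutoffProd χp χm T p k v).Finite := by
  obtain ⟨N, hN⟩ := ht.exists_forall_apply_eq_zero h v
  refine (Set.finite_Icc (min T (p - N)) (max T N)).subset fun k hk => ?_
  by_contra hk'
  apply hk
  simp only [cutoffProd]
  split_ifs with hT
  · have : N ≤ k := by grind
    simp [(hN k this).2]
  · have : N ≤ p - k := by grind
    simp [(hN _ this).1]

theorem cutoffProd_smul_support_finite (h : AnticommRel χp χm) (ht : Truncation χp χm)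
    (c : ℤ → ℂ) (T p : ℤ) (v : V) :
    (Function.support fun k => c k • cutoffProd χp χm T p k v).Finite :=
  (cutoffProd_support_finite h ht T p v).subset fun k hk hk' => hk (by simp_all)

/-- Moving the cutoff changes the ordered products by scalars. -/
theorem cutoffProd_eq_add (h : AnticommRel χp χm) (T p k : ℤ) (v : V) :
    cutoffProd χp χm T p k v = cutoffProd χp χm 0 p k v +
      (if p = 0 then (k : ℂ) * ((if T ≤ k then 1 else 0) - (if 0 ≤ k then 1 else 0)) else 0) •
        v := by
  have hk := h.minus_plus_apply k (p - k) v
  rw [add_sub_cancel] at hk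
  unfold cutoffProd
  split_ifs <;> simp_all [sub_eq_add_neg]

theorem nord_apply_eq_cutoffProd (h : AnticommRel χp χm) (n k : ℤ) (v : V) :
    nord χp χm 0 (n - k) k v = cutoffProd χp χm 0 n k v := by
  have hk := h.minus_plus_apply k (n - k) v
  rw [add_sub_cancel] at hk
  unfold cutoffProd nord
  by_cases hn : n = 0
  · subst hn
    have : (0 ≤ k - (0 - k)) ↔ 0 ≤ k := by omega
    simp only [this]
  · split_ifs <;> simp_all

theorem Vir_eq_finsum_cutoffProd (h : AnticommRel χp χm) (n : ℤ) (v : V) :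
    Vir χp χm n v = ∑ᶠ k : ℤ, cutoffProd χp χm 0 n k v :=
  finsum_congr fun k => nord_apply_eq_cutoffProd h n k v

/-- The Virasoro mode as a linear operator. -/
noncomputable def VirEnd (h : AnticommRel χp χm) (ht : Truncation χp χm) (n : ℤ) :
    Module.End ℂ V where
  toFun v := Vir χp χm n v
  map_add' v w := by
    simp only [Vir_eq_finsum_cutoffProd h, map_add]
    exact finsum_add_distrib (cutoffProd_support_finite h ht _ _ _)
      (cutoffProd_support_finite h ht _ _ _)
  map_smul' c v := by
    simp only [Vir_eq_finsum_cutoffProd h, map_smul, RingHom.id_apply]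
    exact (smul_finsum' c (cutoffProd_support_finite h ht _ _ _)).symm

theorem Vir_plus_apply (h : AnticommRel χp χm) (ht : Truncation χp χm) (n m : ℤ) (v : V) :
    Vir χp χm n (χp m v) = χp m (Vir χp χm n v) - (m : ℂ) • χp (n + m) v := by
  have key (k : ℤ) : cutoffProd χp χm 0 n k (χp m v) =
      χp m (cutoffProd χp χm 0 n k v) + if k = -m then -((m : ℂ) • χp (n + m) v) else 0 := by
    have h1 := h.minus_plus_apply k m
    have h2 := h.plus_plus_apply (n - k) m
    by_cases hk : k = -m
    · subst hk
      unfold cutoffProd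
      split_ifs <;> simp_all <;> abel
    · have hk' : k + m ≠ 0 := by omega
      unfold cutoffProd
      split_ifs <;> simp_all
  simp only [Vir_eq_finsum_cutoffProd h, key]
  rw [finsum_add_distrib, ← AddMonoidHom.coe_coe (χp m),
    AddMonoidHom.map_finsum _ (cutoffProd_support_finite h ht _ _ _),
    finsum_eq_single (fun k => if k = -m then _ else _) (-m)]
  · simp [sub_eq_add_neg]
  · intro k hk
    simp [hk]
  · exact (cutoffProd_support_finite h ht 0 n v).subset fun k hk hk' => hk (by simp_all)
  · exact (Set.finite_singleton (-m)).subset fun k hk => by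
      by_contra hk'
      exact hk (by simp_all)

theorem Vir_minus_apply (h : AnticommRel χp χm) (ht : Truncation χp χm) (n m : ℤ) (v : V) :
    Vir χp χm n (χm m v) = χm m (Vir χp χm n v) - (m : ℂ) • χm (n + m) v := by
  have key (k : ℤ) : cutoffProd χp χm 0 n k (χm m v) =
      χm m (cutoffProd χp χm 0 n k v) +
        if k = n + m then -((m : ℂ) • χm (n + m) v) else 0 := by
    have h1 (w : V) : χp (n - k) (χm m w) =
        (if m + (n - k) = 0 then (m : ℂ) else 0) • w - χm m (χp (n - k) w) := by
      rw [h.minus_plus_apply m (n - k), sub_sub_cancel]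
    have h2 := h.minus_minus_apply k m
    by_cases hk : k = n + m
    · subst hk
      unfold cutoffProd
      split_ifs <;> simp_all <;> abel
    · have hk' : m + (n - k) ≠ 0 := by omega
      unfold cutoffProd
      split_ifs <;> simp_all
  simp only [Vir_eq_finsum_cutoffProd h, key]
  rw [finsum_add_distrib, ← AddMonoidHom.coe_coe (χm m),
    AddMonoidHom.map_finsum _ (cutoffProd_support_finite h ht _ _ _),
    finsum_eq_single (fun k => if k = n + m then _ else _) (n + m)]
  · simp [sub_eq_add_neg]
  · intro k hk
    simp [hk]
  · exact (cutoffProd_support_finite h ht 0 n v).subset fun k hk hk' => hk (by simp_all)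
  · exact (Set.finite_singleton (n + m)).subset fun k hk => by
      by_contra hk'
      exact hk (by simp_all)

theorem Vir_cutoffProd_apply (h : AnticommRel χp χm) (ht : Truncation χp χm)
    (n m k : ℤ) (v : V) :
    Vir χp χm n (cutoffProd χp χm 0 m k v) = cutoffProd χp χm 0 m k (Vir χp χm n v) +
      ((k - m : ℂ) • cutoffProd χp χm 0 (n + m) k v -
        (k : ℂ) • cutoffProd χp χm n (n + m) (n + k) v) := by
  have hneg (w : V) : Vir χp χm n (-w) = -Vir χp χm n w := (VirEnd h ht n).map_neg w
  have e1 : n + (m - k) = n + m - k := by ring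
  have e2 : n + m - (n + k) = m - k := by ring
  have e3 : n ≤ n + k ↔ 0 ≤ k := by omega
  unfold cutoffProd
  simp only [e2, e3]
  split_ifs
  · simp only [Module.End.mul_apply, Vir_plus_apply h ht, Vir_minus_apply h ht, map_sub,
      map_smul, e1]
    push_cast
    module
  · simp only [Module.End.mul_apply, Vir_plus_apply h ht, Vir_minus_apply h ht, map_sub,
      map_smul, e1, LinearMap.neg_apply, hneg]
    push_cast
    module

end SymplecticFermionModes

theorem Finset.sum_range_mul_sub (N : ℕ) :
    ∑ i ∈ Finset.range N, (i : ℂ) * ((N : ℂ) - i) = ((N : ℂ) ^ 3 - N) / 6 := by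
  have aux (c : ℂ) (M : ℕ) : ∑ i ∈ Finset.range M, (i : ℂ) * (c - i) =
      c * (M * (M - 1) / 2) - (M - 1) * M * (2 * M - 1) / 6 := by
    induction M with
    | zero => simp
    | succ M ih =>
      rw [Finset.sum_range_succ, ih]
      push_cast
      ring
  rw [aux]
  ring

/-- The scalar produced by moving the cutoff from `0` to `n`, weighted by `k - n`. -/
noncomputable def cutoffAnomaly (n k : ℤ) : ℂ :=
  ((k : ℂ) - n) * (k * ((if n ≤ k then 1 else 0) - (if 0 ≤ k then 1 else 0)))

theorem cutoffAnomaly_support_finite (n : ℤ) : (Function.support (cutoffAnomaly n)).Finite := by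
  refine (Set.finite_Icc (min 0 n) (max 0 n)).subset fun k hk => ?_
  by_contra hk'
  apply hk
  have : (n ≤ k) ↔ (0 ≤ k) := by grind
  simp [cutoffAnomaly, this]

theorem finsum_cutoffAnomaly (n : ℤ) :
    ∑ᶠ k : ℤ, cutoffAnomaly n k = ((n : ℂ) ^ 3 - n) / 6 := by
  obtain ⟨N, rfl | rfl⟩ := n.eq_nat_or_neg
  · rw [finsum_eq_sum_of_support_subset (s := (Finset.range N).map Nat.castEmbedding)]
    · rw [Finset.sum_map]
      push_cast
      rw [← Finset.sum_range_mul_sub]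
      refine Finset.sum_congr rfl fun i hi => ?_
      have : ¬ N ≤ i := by simpa using hi
      simp [cutoffAnomaly, this]
      ring
    · intro k hk
      by_contra hk'
      apply hk
      have : ((N : ℤ) ≤ k) ↔ (0 ≤ k) := by
        refine ⟨by omega, fun h0 => ?_⟩
        by_contra hN
        exact hk' (by simpa using ⟨k.toNat, by omega, by omega⟩)
      simp [cutoffAnomaly, this]
  · rw [← finsum_comp_equiv (Equiv.neg ℤ), finsum_eq_sum_of_support_subset
      (s := (Finset.range N).map Nat.castEmbedding)]
    · rw [Finset.sum_map]
      push_cast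
      have hodd : ((-(N : ℂ)) ^ 3 - -(N : ℂ)) / 6 = -(((N : ℂ) ^ 3 - N) / 6) := by ring
      rw [hodd, ← Finset.sum_range_mul_sub, ← Finset.sum_neg_distrib]
      refine Finset.sum_congr rfl fun i hi => ?_
      have hi' : i ≤ N := (Finset.mem_range.1 hi).le
      rcases eq_or_ne i 0 with rfl | h0
      · simp [cutoffAnomaly]
      · simp [cutoffAnomaly, h0, hi']
        ring
    · intro k hk
      by_contra hk'
      apply hk
      by_cases hN : k = N
      · simp [cutoffAnomaly, hN]
      have : k ≤ N ↔ k ≤ 0 := by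
        refine ⟨fun h1 => ?_, by omega⟩
        by_contra h0
        exact hk' (by simpa using ⟨k.toNat, by omega, by omega⟩)
      simp [cutoffAnomaly, this]

/-- the Sugawara operators satisfy the Virasoro commutation relations
with central charge c = −2:
[Lₙ, Lₘ] = (n−m)·L_{n+m} + (c/12)·(n³−n)·δ_{n+m,0}·id with c = −2. -/
theorem virasoro_relations_central_charge_neg_two
    (χp χm : ℤ → Module.End ℂ V)
    (hanti : AnticommRel χp χm) (htrunc : Truncation χp χm)
    (n m : ℤ) (v : V) :
    Vir χp χm n (Vir χp χm m v) - Vir χp χm m (Vir χp χm n v)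
      = ((n - m : ℤ) : ℂ) • Vir χp χm (n + m) v +
        (if n + m = 0 then ((-2 : ℂ) / 12) * (((n : ℂ)) ^ 3 - (n : ℂ)) else 0) • v := by
  have hshift : ∑ᶠ k : ℤ, (k : ℂ) • cutoffProd χp χm n (n + m) (n + k) v =
      ∑ᶠ k : ℤ, ((k : ℂ) - n) • cutoffProd χp χm n (n + m) k v := by
    rw [← finsum_comp_equiv (Equiv.addLeft n)
      (f := fun k : ℤ => ((k : ℂ) - n) • cutoffProd χp χm n (n + m) k v)]
    simp
  have hshift_fin :
      (Function.support fun k : ℤ => (k : ℂ) • cutoffProd χp χm n (n + m) (n + k) v).Finite := by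
    refine ((cutoffProd_support_finite hanti htrunc n (n + m) v).preimage
      (add_right_injective n).injOn).subset fun k hk hk' => hk ?_
    simp_all
  have hmain := cutoffProd_smul_support_finite hanti htrunc
  have hcomm : Vir χp χm n (Vir χp χm m v) = Vir χp χm m (Vir χp χm n v) +
      (∑ᶠ k : ℤ, ((k : ℂ) - m) • cutoffProd χp χm 0 (n + m) k v -
        ∑ᶠ k : ℤ, ((k : ℂ) - n) • cutoffProd χp χm n (n + m) k v) := by
    have hmap : Vir χp χm n (∑ᶠ k : ℤ, cutoffProd χp χm 0 m k v) =
        ∑ᶠ k : ℤ, Vir χp χm n (cutoffProd χp χm 0 m k v) :=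
      (VirEnd hanti htrunc n).toAddMonoidHom.map_finsum
        (cutoffProd_support_finite hanti htrunc 0 m v)
    rw [Vir_eq_finsum_cutoffProd hanti m v, hmap]
    simp only [Vir_cutoffProd_apply hanti htrunc]
    rw [finsum_add_distrib (cutoffProd_support_finite hanti htrunc 0 m _)
      (((hmain (fun k => (k : ℂ) - m) 0 (n + m) v).union hshift_fin).subset
        (Function.support_sub _ _)),
      finsum_sub_distrib (hmain (fun k => (k : ℂ) - m) 0 (n + m) v) hshift_fin, hshift,
      ← Vir_eq_finsum_cutoffProd hanti]
  have hdiff (k : ℤ) : ((k : ℂ) - m) • cutoffProd χp χm 0 (n + m) k v -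
      ((k : ℂ) - n) • cutoffProd χp χm n (n + m) k v =
      ((n - m : ℤ) : ℂ) • cutoffProd χp χm 0 (n + m) k v -
        (if n + m = 0 then cutoffAnomaly n k else 0) • v := by
    rw [cutoffProd_eq_add hanti n]
    unfold cutoffAnomaly
    by_cases hnm : n + m = 0
    · simp only [hnm, if_true]
      push_cast
      module
    · simp only [hnm, if_false]
      push_cast
      module
  rw [hcomm, add_sub_cancel_left,
    ← finsum_sub_distrib (hmain (fun k => (k : ℂ) - m) 0 (n + m) v)
      (hmain (fun k => (k : ℂ) - n) n (n + m) v)]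
  simp only [hdiff]
  have hanom : (Function.support fun k : ℤ =>
      (if n + m = 0 then cutoffAnomaly n k else 0) • v).Finite :=
    (cutoffAnomaly_support_finite n).subset fun k hk hk' => hk (by simp_all)
  rw [finsum_sub_distrib (hmain (fun _ => ((n - m : ℤ) : ℂ)) 0 (n + m) v) hanom,
    ← smul_finsum' _ (cutoffProd_support_finite hanti htrunc 0 (n + m) v),
    ← Vir_eq_finsum_cutoffProd hanti, sub_eq_add_neg]
  congr 1
  by_cases hnm : n + m = 0
  · simp only [hnm, if_true]
    rw [← finsum_smul' (cutoffAnomaly_support_finite n), finsum_cutoffAnomaly, ← neg_smul]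
    congr 1
    ring
  · simp [hnm]
end
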